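/- Let J_n be a sequence of 2×2 real matrices with J_n² = −Id converging to J, and B_n a sequence of continuous matrix-valued functions on S¹ converging uniformly to B. Define operators A_n : W^{1,2}(S¹,ℝ²) → L²(S¹,ℝ²) by A_n ξ = −J_n ξ' − B_n ξ, and similarly A ξ = −J ξ' − B ξ. Suppose ξ_n ∈ W^{1,2}(S¹,ℝ²) satisfy ‖ξ_n‖_{L²} = 1 and ‖A_n ξ_n‖_{L²} → 0. Then, after passing to a subsequence, ξ_n converges in W^{1,2}(S¹,ℝ²) to some ξ with ‖ξ‖_{L²} = 1 solving ξ'(t) = −J^{-1} B(t) ξ(t) (equivalently A ξ = 0). -/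

import Mathlib

open MeasureTheory intervalIntegral Filter
noncomputable section
abbrev E2 := EuclideanSpace ℝ (Fin 2)

theorem aux_cs (f : ℝ → ℝ) (hf : Continuous f) :
    (∫ t in (0:ℝ)..1, f t) ^ 2 ≤ ∫ t in (0:ℝ)..1, f t ^ 2 := by
  set m := ∫ t in (0:ℝ)..1, f t with hm
  have h : 0 ≤ ∫ t in (0:ℝ)..1, (f t - m) ^ 2 :=
    intervalIntegral.integral_nonneg (by norm_num) (fun t _ => sq_nonneg _)
  have e : (fun t => (f t - m) ^ 2) = fun t => (f t ^ 2 - (2 * m) * f t) + m ^ 2 := by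
    funext t; ring
  rw [e, intervalIntegral.integral_add, intervalIntegral.integral_sub,
    intervalIntegral.integral_const_mul, ← hm] at h
  · simp at h; nlinarith
  all_goals exact Continuous.intervalIntegrable (by fun_prop) _ _

theorem aux_bdd {F : Type*} [NormedAddCommGroup F] (f : ℝ → F) (hf : Continuous f)
    (hp : ∀ t, f (t + 1) = f t) : ∃ C, ∀ t, ‖f t‖ ≤ C := by
  obtain ⟨C, hC⟩ := (isCompact_Icc (a := (0:ℝ)) (b := 1)).exists_bound_of_continuousOn
    hf.continuousOn
  refine ⟨C, fun t => ?_⟩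
  have hp' : Function.Periodic f 1 := hp
  obtain ⟨y, hy, h⟩ := hp'.exists_mem_Ico₀ one_pos t
  rw [h]; exact hC y ⟨hy.1, hy.2.le⟩

theorem aux_unif {F : Type*} [NormedAddCommGroup F] (B : ℕ → ℝ → F) (Bl : ℝ → F)
    (hB : ∀ n, Continuous (B n)) (hp : ∀ n t, B n (t + 1) = B n t)
    (hc : TendstoUniformly (fun n t => B n t) Bl atTop) :
    ∃ C, ∀ n t, ‖B n t‖ ≤ C := by
  choose c hc' using fun n => aux_bdd (B n) (hB n) (hp n)
  have hl : Continuous Bl := hc.continuous (Frequently.of_forall hB)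
  have hlp : ∀ t, Bl (t + 1) = Bl t := by
    intro t
    have h1 := hc.tendsto_at (t + 1)
    simp only [hp] at h1
    exact tendsto_nhds_unique h1 (hc.tendsto_at t)
  obtain ⟨K, hK⟩ := aux_bdd Bl hl hlp
  have := Metric.tendstoUniformly_iff.1 hc 1 one_pos
  obtain ⟨N, hN⟩ := eventually_atTop.1 this
  refine ⟨(∑ i ∈ Finset.range N, |c i|) + (|K| + 1), fun n t => ?_⟩
  have hs : 0 ≤ ∑ i ∈ Finset.range N, |c i| := Finset.sum_nonneg fun i _ => abs_nonneg _
  by_cases h : n < N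
  · have := Finset.single_le_sum (f := fun i => |c i|) (fun i _ => abs_nonneg _)
      (Finset.mem_range.2 h)
    have h2 := hc' n t
    have h3 := le_abs_self (c n)
    have := abs_nonneg K
    linarith
  · have h1 := hN n (not_lt.1 h) t
    rw [dist_comm, dist_eq_norm] at h1
    have h2 := norm_le_norm_sub_add (B n t) (Bl t)
    have h3 := hK t
    have h4 := le_abs_self K
    linarith

theorem aux_AA (u : ℕ → ℝ → E2) (K : NNReal) (M : ℝ) (hu : ∀ n, LipschitzWith K (u n))
    (hM : ∀ n, ∀ t ∈ Set.Icc (0:ℝ) 1, ‖u n t‖ ≤ M) :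
    ∃ φ : ℕ → ℕ, StrictMono φ ∧ ∀ t ∈ Set.Icc (0:ℝ) 1, ∃ v,
      Tendsto (fun n => u (φ n) t) atTop (nhds v) := by
  let U : ℕ → BoundedContinuousFunction (Set.Icc (0:ℝ) 1) E2 := fun n =>
    BoundedContinuousFunction.mkOfCompact ⟨fun t => u n t, (hu n).continuous.comp continuous_subtype_val⟩
  have hcpt : IsCompact (closure (Set.range U)) := by
    refine BoundedContinuousFunction.arzela_ascoli (Metric.closedBall (0:E2) M)
      (isCompact_closedBall _ _) _ ?_ ?_
    · rintro f x ⟨n, rfl⟩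
      simpa [U] using hM n x x.2
    · refine (Metric.uniformEquicontinuous_of_continuity_modulus (fun s => K * s) ?_ _ ?_).equicontinuous
      · have : Continuous fun s : ℝ => (K:ℝ) * s := by fun_prop
        simpa using this.tendsto 0
      · rintro x y ⟨f, n, rfl⟩
        exact (hu n).dist_le_mul x y
  obtain ⟨V, -, φ, hφ, h⟩ := hcpt.tendsto_subseq (x := U) (fun n => subset_closure ⟨n, rfl⟩)
  refine ⟨φ, hφ, fun t ht => ⟨V ⟨t, ht⟩, ?_⟩⟩
  have := (BoundedContinuousFunction.tendsto_iff_tendstoUniformly.1 h).tendsto_at ⟨t, ht⟩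
  simpa [U] using this

theorem aux_per_int (f : ℝ → ℝ) (hf : Continuous f) (h0 : ∀ t, 0 ≤ f t)
    (hp : ∀ t, f (t + 1) = f t) (N : ℕ) (s t : ℝ) (hs : |s| ≤ N) (ht : |t| ≤ N) :
    |∫ x in s..t, f x| ≤ (2 * N) * ∫ x in (0:ℝ)..1, f x := by
  have hp' : Function.Periodic f 1 := hp
  have h1 := hp'.intervalIntegral_add_zsmul_eq (2 * N : ℤ) (-(N:ℝ))
    (fun a b => hf.intervalIntegrable a b)
  have h2 := hp'.intervalIntegral_add_eq (-(N:ℝ)) 0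
  rw [h2] at h1
  simp only [zero_add, zsmul_eq_mul, mul_one] at h1
  push_cast at h1
  rw [← h1]
  have hN : -(N:ℝ) ≤ -(N:ℝ) + 2 * N := by
    have : (0:ℝ) ≤ N := Nat.cast_nonneg N
    linarith
  rw [← abs_of_nonneg (intervalIntegral.integral_nonneg (f := f) (μ := volume) hN (fun t _ => h0 t))]
  have hs := abs_le.1 hs
  have ht := abs_le.1 ht
  apply intervalIntegral.abs_integral_mono_interval
  · rw [Set.uIoc_of_le hN, Set.uIoc]
    apply Set.Ioc_subset_Ioc
    · exact le_min hs.1 ht.1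
    · apply max_le <;> linarith
  · exact Eventually.of_forall h0
  · exact hf.intervalIntegrable _ _

/-- sup bound -/
theorem aux_sup (x : ℝ → E2) (hd : Differentiable ℝ x) (hc : Continuous (deriv x))
    (hp : ∀ t, x (t + 1) = x t) (hn : (∫ t in (0:ℝ)..1, ‖x t‖ ^ 2) = 1) (D : ℝ)
    (hD : (∫ t in (0:ℝ)..1, ‖deriv x t‖) ≤ D) : ∀ t, ‖x t‖ ≤ 1 + D := by
  have hxc := hd.continuous
  obtain ⟨s, hs, hs1⟩ : ∃ s ∈ Set.Icc (0:ℝ) 1, ‖x s‖ ≤ 1 := by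
    by_contra! h
    have : (∫ t in (0:ℝ)..1, (1:ℝ)) < ∫ t in (0:ℝ)..1, ‖x t‖ ^ 2 := by
      apply intervalIntegral.integral_lt_integral_of_continuousOn_of_le_of_exists_lt one_pos
        (by fun_prop) (by fun_prop)
      · intro t ht
        have := h t ⟨ht.1.le, ht.2⟩
        nlinarith
      · exact ⟨0, by simp, by have := h 0 (by simp); nlinarith⟩
    simp [hn] at this
  intro t
  have hp' : Function.Periodic x 1 := hp
  obtain ⟨y, hy, h⟩ := hp'.exists_mem_Ico₀ one_pos t
  rw [h]
  have e : x y = x s + ∫ r in s..y, deriv x r := by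
    rw [intervalIntegral.integral_deriv_eq_sub (fun _ _ => hd _) (hc.intervalIntegrable _ _)]
    abel
  have h2 : ‖∫ r in s..y, deriv x r‖ ≤ D := by
    refine (intervalIntegral.norm_integral_le_abs_integral_norm).trans ?_
    refine le_trans ?_ hD
    rw [← abs_of_nonneg (intervalIntegral.integral_nonneg (f := fun t => ‖deriv x t‖) (μ := volume)
      (zero_le_one (α := ℝ)) (fun t _ => norm_nonneg _))]
    apply intervalIntegral.abs_integral_mono_interval
    · rw [Set.uIoc_of_le zero_le_one, Set.uIoc]
      apply Set.Ioc_subset_Ioc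
      · exact le_min hs.1 hy.1
      · exact max_le hs.2 hy.2.le
    · exact Eventually.of_forall fun _ => norm_nonneg _
    · exact hc.norm.intervalIntegrable _ _
  rw [e]
  exact (norm_add_le _ _).trans (add_le_add hs1 h2)

/-- Functional-analytic core of Lemma 4.6: if `A_n ξ = −J_n ξ' − B_n ξ` with
`J_n² = −Id`, `J_n → J`, `B_n → B` uniformly, and `ξ_n` satisfy `‖ξ_n‖_{L²} = 1`,
`‖A_n ξ_n‖_{L²} → 0`, then a subsequence of `ξ_n` converges in `W^{1,2}(S¹,ℝ²)`
to a solution `ξ` of `A ξ = 0` with `‖ξ‖_{L²} = 1`. -/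
theorem subsequence_converges_to_kernel_element
    (J : ℕ → E2 →L[ℝ] E2) (Jlim : E2 →L[ℝ] E2)
    (B : ℕ → ℝ → E2 →L[ℝ] E2) (Blim : ℝ → E2 →L[ℝ] E2)
    (ξ : ℕ → ℝ → E2)
    (hJsq : ∀ n, J n * J n = -1)
    (hJconv : Tendsto J atTop (nhds Jlim))
    (hBcont : ∀ n, Continuous (B n))
    (hBper : ∀ n t, B n (t + 1) = B n t)
    (hBconv : TendstoUniformly (fun n t => B n t) Blim atTop)
    (hξdiff : ∀ n, Differentiable ℝ (ξ n))
    (hξderiv : ∀ n, Continuous (deriv (ξ n)))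
    (hξper : ∀ n t, ξ n (t + 1) = ξ n t)
    (hξnorm : ∀ n, (∫ t in (0:ℝ)..1, ‖ξ n t‖ ^ 2) = 1)
    (hAconv : Tendsto
      (fun n => ∫ t in (0:ℝ)..1, ‖-(J n (deriv (ξ n) t)) - B n t (ξ n t)‖ ^ 2)
      atTop (nhds 0)) :
    ∃ φ : ℕ → ℕ, StrictMono φ ∧
      ∃ ξlim : ℝ → E2,
        Differentiable ℝ ξlim ∧
        (∀ t, ξlim (t + 1) = ξlim t) ∧
        Tendsto (fun n => ∫ t in (0:ℝ)..1,
            (‖ξ (φ n) t - ξlim t‖ ^ 2 + ‖deriv (ξ (φ n)) t - deriv ξlim t‖ ^ 2))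
          atTop (nhds 0) ∧
        (∫ t in (0:ℝ)..1, ‖ξlim t‖ ^ 2) = 1 ∧
        (∀ t, -(Jlim (deriv ξlim t)) - Blim t (ξlim t) = 0) := by
  set η : ℕ → ℝ → E2 := fun n t => -(J n (deriv (ξ n) t)) - B n t (ξ n t) with hη
  set g : ℕ → ℝ → E2 := fun n t => J n (B n t (ξ n t)) with hg
  have hJJ : ∀ n v, J n (J n v) = -v := fun n v => by
    have := congrArg (fun T : E2 →L[ℝ] E2 => T v) (hJsq n)
    simpa using this
  have hlJJ : ∀ v, Jlim (Jlim v) = -v := fun v => by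
    have h1 : Tendsto (fun n => J n * J n) atTop (nhds (Jlim * Jlim)) := hJconv.mul hJconv
    simp only [hJsq] at h1
    have h2 := tendsto_nhds_unique h1 tendsto_const_nhds
    have := congrArg (fun T : E2 →L[ℝ] E2 => T v) h2
    simpa using this
  have hξ' : ∀ n t, deriv (ξ n) t = J n (η n t) + g n t := fun n t => by
    simp only [hη, hg, map_sub, map_neg, hJJ]; abel
  have hξc : ∀ n, Continuous (ξ n) := fun n => (hξdiff n).continuous
  have hgc : ∀ n, Continuous (g n) := fun n => by
    have := hξc n; have := hBcont n; simp only [hg]; fun_prop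
  have hηc : ∀ n, Continuous (η n) := fun n => by
    have := hξc n; have := hBcont n; have := hξderiv n; simp only [hη]; fun_prop
  have hdp : ∀ n t, deriv (ξ n) (t + 1) = deriv (ξ n) t := fun n t => by
    rw [← deriv_comp_add_const]
    congr 1
    funext s; exact hξper n s
  have hηp : ∀ n t, η n (t + 1) = η n t := fun n t => by
    simp only [hη, hdp, hBper, hξper]
  have ha : Tendsto (fun n => ∫ t in (0:ℝ)..1, ‖η n t‖) atTop (nhds 0) := by
    have h1 : Tendsto (fun n => (∫ t in (0:ℝ)..1, ‖η n t‖) ^ 2) atTop (nhds 0) :=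
      squeeze_zero (fun n => sq_nonneg _) (fun n => aux_cs _ (hηc n).norm) hAconv
    have h2 := h1.sqrt
    simp only [Real.sqrt_zero] at h2
    refine h2.congr fun n => Real.sqrt_sq ?_
    exact intervalIntegral.integral_nonneg zero_le_one fun t _ => norm_nonneg _
  obtain ⟨CJ, hCJ⟩ : ∃ C, ∀ n, ‖J n‖ ≤ C := by
    obtain ⟨C, hC⟩ := hJconv.norm.bddAbove_range
    exact ⟨C, fun n => hC ⟨n, rfl⟩⟩
  have hCJ0 : 0 ≤ CJ := (norm_nonneg _).trans (hCJ 0)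
  obtain ⟨CB, hCB⟩ := aux_unif B Blim hBcont hBper hBconv
  have hCB0 : 0 ≤ CB := (norm_nonneg _).trans (hCB 0 0)
  obtain ⟨Ca, hCa⟩ : ∃ C, ∀ n, (∫ t in (0:ℝ)..1, ‖η n t‖) ≤ C := by
    obtain ⟨C, hC⟩ := ha.bddAbove_range
    exact ⟨C, fun n => hC ⟨n, rfl⟩⟩
  have hBlc : Continuous Blim := hBconv.continuous (Frequently.of_forall hBcont)
  have hJη : ∀ n t, ‖J n (η n t)‖ ≤ CJ * ‖η n t‖ := fun n t => (J n).le_of_opNorm_le (hCJ n) _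
  have hgb : ∀ n t, ‖g n t‖ ≤ CJ * (CB * ‖ξ n t‖) := fun n t =>
    ((J n).le_of_opNorm_le (hCJ n) _).trans
      (mul_le_mul_of_nonneg_left ((B n t).le_of_opNorm_le (hCB n t) _) hCJ0)
  obtain ⟨M, hM⟩ : ∃ M, ∀ n t, ‖ξ n t‖ ≤ M := by
    refine ⟨1 + (CJ * Ca + CJ * CB), fun n => aux_sup (ξ n) (hξdiff n) (hξderiv n) (hξper n)
      (hξnorm n) _ ?_⟩
    have h1 : (∫ t in (0:ℝ)..1, ‖ξ n t‖) ≤ 1 := by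
      have := aux_cs _ (hξc n).norm
      rw [hξnorm n] at this
      exact (sq_le_one_iff_abs_le_one _).1 this |> (le_abs_self _).trans
    have h2 : (∫ t in (0:ℝ)..1, ‖deriv (ξ n) t‖) ≤
        ∫ t in (0:ℝ)..1, (CJ * ‖η n t‖ + (CJ * CB) * ‖ξ n t‖) := by
      apply intervalIntegral.integral_mono_on zero_le_one
        ((hξderiv n).norm.intervalIntegrable _ _)
      · exact Continuous.intervalIntegrable
          (((hηc n).norm.const_mul _).add ((hξc n).norm.const_mul _)) _ _
      · intro t _
        rw [hξ', mul_assoc]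
        exact (norm_add_le _ _).trans (add_le_add (hJη n t) (hgb n t))
    refine h2.trans ?_
    rw [intervalIntegral.integral_add
      (((hηc n).norm.const_mul _).intervalIntegrable _ _)
      (((hξc n).norm.const_mul _).intervalIntegrable _ _),
      intervalIntegral.integral_const_mul, intervalIntegral.integral_const_mul]
    have h3 := mul_le_mul_of_nonneg_left (hCa n) hCJ0
    have h4 := mul_le_mul_of_nonneg_left h1 (mul_nonneg hCJ0 hCB0)
    linarith
  have hM0 : 0 ≤ M := (norm_nonneg _).trans (hM 0 0)
  set L : ℝ := CJ * (CB * M) with hL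
  have hL0 : 0 ≤ L := by positivity
  have hgL : ∀ n t, ‖g n t‖ ≤ L := fun n t => (hgb n t).trans
    (mul_le_mul_of_nonneg_left (mul_le_mul_of_nonneg_left (hM n t) hCB0) hCJ0)
  set e : ℕ → ℝ → E2 := fun n t => ∫ s in (0:ℝ)..t, J n (η n s) with he
  set u : ℕ → ℝ → E2 := fun n t => ξ n 0 + ∫ s in (0:ℝ)..t, g n s with hu
  have hJηc : ∀ n, Continuous fun s => J n (η n s) := fun n => (J n).continuous.comp (hηc n)
  have hξue : ∀ n t, ξ n t = u n t + e n t := fun n t => by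
    have h1 := intervalIntegral.integral_deriv_eq_sub (f := ξ n) (a := 0) (b := t)
      (fun _ _ => hξdiff n _) ((hξderiv n).intervalIntegrable _ _)
    simp only [hξ'] at h1
    rw [intervalIntegral.integral_add ((hJηc n).intervalIntegrable _ _)
      ((hgc n).intervalIntegrable _ _)] at h1
    simp only [hu, he]
    rw [add_assoc, add_comm (∫ s in (0:ℝ)..t, g n s), h1]; abel
  have hebd : ∀ n (N : ℕ) (t : ℝ), |t| ≤ N → ‖e n t‖ ≤ CJ * (2 * N * ∫ s in (0:ℝ)..1, ‖η n s‖) := by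
    intro n N t ht
    refine (intervalIntegral.norm_integral_le_abs_of_norm_le (g := fun s => CJ * ‖η n s‖)
      (Eventually.of_forall fun s => hJη n s) (((hηc n).norm.const_mul _).intervalIntegrable _ _)).trans ?_
    rw [intervalIntegral.integral_const_mul, abs_mul, abs_of_nonneg hCJ0]
    refine mul_le_mul_of_nonneg_left ?_ hCJ0
    exact aux_per_int _ (hηc n).norm (fun _ => norm_nonneg _) (fun t => by simp only [hηp]) N 0 t
      (by simp) ht
  have he0 : ∀ t, Tendsto (fun n => e n t) atTop (nhds 0) := fun t => by
    refine squeeze_zero_norm (fun n => hebd n ⌈|t|⌉₊ t (Nat.le_ceil _)) ?_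
    simpa using (ha.const_mul (2 * (⌈|t|⌉₊:ℝ))).const_mul CJ
  have huL : ∀ n, LipschitzWith ⟨L, hL0⟩ (u n) := fun n => by
    refine LipschitzWith.of_dist_le_mul fun s t => ?_
    have : u n s - u n t = ∫ r in t..s, g n r := by
      simp only [hu]
      rw [add_sub_add_left_eq_sub]
      exact intervalIntegral.integral_interval_sub_left ((hgc n).intervalIntegrable _ _)
        ((hgc n).intervalIntegrable _ _)
    rw [dist_eq_norm, this, Real.dist_eq]
    exact intervalIntegral.norm_integral_le_of_norm_le_const fun r _ => hgL n r
  obtain ⟨φ, hφ, hlim⟩ := aux_AA u ⟨L, hL0⟩ (M + CJ * (2 * (1:ℕ) * Ca)) huL (by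
    intro n t ht
    have h1 : u n t = ξ n t - e n t := by rw [hξue n t]; abel
    rw [h1]
    refine (norm_sub_le _ _).trans (add_le_add (hM n t) ((hebd n 1 t ?_).trans ?_))
    · rw [abs_of_nonneg ht.1]; simpa using ht.2
    · exact mul_le_mul_of_nonneg_left (mul_le_mul_of_nonneg_left (hCa n) (by norm_num)) hCJ0)
  have hlim' : ∀ t, ∃ v, Tendsto (fun n => ξ (φ n) t) atTop (nhds v) := by
    intro t
    have hper : ∀ n, ξ n t = ξ n (Int.fract t) := fun n => by
      have hp' : Function.Periodic (ξ n) 1 := hξper n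
      have := hp'.sub_int_mul_eq (x := t) ⌊t⌋
      rw [mul_one] at this
      exact this.symm
    obtain ⟨v, hv⟩ := hlim (Int.fract t) ⟨Int.fract_nonneg t, (Int.fract_lt_one t).le⟩
    refine ⟨v, ?_⟩
    have := hv.add ((he0 (Int.fract t)).comp hφ.tendsto_atTop)
    rw [add_zero] at this
    refine this.congr fun n => ?_
    rw [hper, hξue]; rfl
  choose x hx using hlim'
  have hux : ∀ t, Tendsto (fun n => u (φ n) t) atTop (nhds (x t)) := fun t => by
    have := (hx t).sub ((he0 t).comp hφ.tendsto_atTop)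
    rw [sub_zero] at this
    refine this.congr fun n => ?_
    simp only [Function.comp, hξue]; abel
  have hxc : Continuous x := by
    have : LipschitzWith ⟨L, hL0⟩ x := LipschitzWith.of_dist_le_mul fun s t =>
      le_of_tendsto ((hux s).dist (hux t)) (Eventually.of_forall fun n => (huL (φ n)).dist_le_mul s t)
    exact this.continuous
  have hxM : ∀ t, ‖x t‖ ≤ M := fun t =>
    le_of_tendsto (hx t).norm (Eventually.of_forall fun n => hM _ _)
  have hxp : ∀ t, x (t + 1) = x t := fun t => by
    have h1 := hx (t + 1)
    simp only [hξper] at h1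
    exact tendsto_nhds_unique h1 (hx t)
  set G : ℝ → E2 := fun t => Jlim (Blim t (x t)) with hG
  have hGc : Continuous G := by simp only [hG]; fun_prop
  have hgG : ∀ t, Tendsto (fun n => g (φ n) t) atTop (nhds (G t)) := fun t => by
    have h1 := (hBconv.tendsto_at t).comp hφ.tendsto_atTop
    have h2 := hJconv.comp hφ.tendsto_atTop
    have hev : Continuous fun p : (E2 →L[ℝ] E2) × E2 => p.1 p.2 :=
      isBoundedBilinearMap_apply.continuous
    have h3 := (hev.tendsto (Blim t, x t)).comp (h1.prodMk_nhds (hx t))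
    exact (hev.tendsto (Jlim, Blim t (x t))).comp (h2.prodMk_nhds h3)
  have hGL : ∀ t, ‖G t‖ ≤ L := fun t =>
    le_of_tendsto (hgG t).norm (Eventually.of_forall fun n => hgL _ _)
  have hxeq : ∀ t, x t = x 0 + ∫ s in (0:ℝ)..t, G s := fun t => by
    refine tendsto_nhds_unique (hux t) ?_
    refine (hx 0).add ?_
    refine intervalIntegral.tendsto_integral_filter_of_dominated_convergence (fun _ => L) ?_ ?_ ?_ ?_
    · exact Eventually.of_forall fun n => (hgc _).aestronglyMeasurable
    · exact Eventually.of_forall fun n => Eventually.of_forall fun s _ => hgL _ _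
    · exact intervalIntegrable_const
    · exact Eventually.of_forall fun s _ => hgG s
  have hxd : ∀ t, HasDerivAt x (G t) t := fun t => by
    have h1 := (intervalIntegral.integral_hasDerivAt_right (hGc.intervalIntegrable 0 t)
      (hGc.stronglyMeasurableAtFilter _ _) hGc.continuousAt).const_add (x 0)
    exact h1.congr_of_eventuallyEq (Eventually.of_forall hxeq)
  have hxd' : ∀ t, deriv x t = G t := fun t => (hxd t).deriv
  refine ⟨φ, hφ, x, fun t => (hxd t).differentiableAt, hxp, ?_, ?_, ?_⟩
  · have hA := (hAconv.comp hφ.tendsto_atTop).const_mul (2 * CJ ^ 2)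
    have hD : Tendsto (fun n => ∫ t in (0:ℝ)..1,
        (‖ξ (φ n) t - x t‖ ^ 2 + 2 * ‖g (φ n) t - G t‖ ^ 2)) atTop
        (nhds (∫ t in (0:ℝ)..1, (0:ℝ))) := by
      refine intervalIntegral.tendsto_integral_filter_of_dominated_convergence
        (fun _ => (M + M) ^ 2 + 2 * (L + L) ^ 2) ?_ ?_ ?_ ?_
      · exact Eventually.of_forall fun n => Continuous.aestronglyMeasurable
          ((((hξc _).sub hxc).norm.pow 2).add ((((hgc _).sub hGc).norm.pow 2).const_mul 2))
      · refine Eventually.of_forall fun n => Eventually.of_forall fun s _ => ?_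
        rw [Real.norm_of_nonneg (by positivity)]
        have h1 := (norm_sub_le (ξ (φ n) s) (x s)).trans (add_le_add (hM _ _) (hxM s))
        have h2 := (norm_sub_le (g (φ n) s) (G s)).trans (add_le_add (hgL _ _) (hGL s))
        gcongr
      · exact intervalIntegrable_const
      · refine Eventually.of_forall fun s _ => ?_
        have h1 := ((hx s).sub_const (x s)).norm.pow 2
        have h2 := (((hgG s).sub_const (G s)).norm.pow 2).const_mul 2
        simpa using h1.add h2
    have hS := hD.add hA
    rw [intervalIntegral.integral_zero, mul_zero, add_zero] at hS
    refine squeeze_zero (fun n => ?_) (fun n => ?_) hS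
    · exact intervalIntegral.integral_nonneg zero_le_one fun t _ => by positivity
    · simp only [Function.comp]
      have hc1 : Continuous fun t => ‖ξ (φ n) t - x t‖ ^ 2 + 2 * ‖g (φ n) t - G t‖ ^ 2 :=
        ((((hξc _).sub hxc).norm.pow 2).add ((((hgc _).sub hGc).norm.pow 2).const_mul 2))
      have hc2 : Continuous fun t => 2 * CJ ^ 2 * ‖η (φ n) t‖ ^ 2 :=
        ((hηc _).norm.pow 2).const_mul _
      rw [← intervalIntegral.integral_const_mul, ← intervalIntegral.integral_add
        (hc1.intervalIntegrable _ _) (hc2.intervalIntegrable _ _)]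
      simp only [hxd']
      apply intervalIntegral.integral_mono_on zero_le_one
      · exact Continuous.intervalIntegrable
          ((((hξc _).sub hxc).norm.pow 2).add (((hξderiv _).sub hGc).norm.pow 2)) _ _
      · exact (hc1.add hc2).intervalIntegrable _ _
      · intro t _
        have h1 : ‖deriv (ξ (φ n)) t - G t‖ ≤ CJ * ‖η (φ n) t‖ + ‖g (φ n) t - G t‖ := by
          rw [hξ', add_sub_assoc]
          exact (norm_add_le _ _).trans (by have := hJη (φ n) t; gcongr)
        have h2 : ‖deriv (ξ (φ n)) t - G t‖ ^ 2 ≤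
            (CJ * ‖η (φ n) t‖ + ‖g (φ n) t - G t‖) ^ 2 := by gcongr
        have h3 := sq_nonneg (CJ * ‖η (φ n) t‖ - ‖g (φ n) t - G t‖)
        nlinarith
  · have h1 : Tendsto (fun n => ∫ t in (0:ℝ)..1, ‖ξ (φ n) t‖ ^ 2) atTop
        (nhds (∫ t in (0:ℝ)..1, ‖x t‖ ^ 2)) := by
      refine intervalIntegral.tendsto_integral_filter_of_dominated_convergence
        (fun _ => M ^ 2) ?_ ?_ ?_ ?_
      · exact Eventually.of_forall fun n => ((hξc _).norm.pow 2).aestronglyMeasurable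
      · refine Eventually.of_forall fun n => Eventually.of_forall fun s _ => ?_
        rw [Real.norm_of_nonneg (by positivity)]
        have := hM (φ n) s
        gcongr
      · exact intervalIntegrable_const
      · exact Eventually.of_forall fun s _ => (hx s).norm.pow 2
    simp only [hξnorm] at h1
    exact tendsto_nhds_unique h1 tendsto_const_nhds
  · intro t
    rw [hxd']
    simp only [hG, hlJJ]
    abel

end
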